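/- Failure of quantifier elimination for RCF in any relevant logic between B and RM: let C be any class of B-models over the signature of RCF that contains every RM-model. Then there is a formula with one free variable x, namely ∀y,z((x<y ∧ y<z ∧ ¬(y<z)) → ¬∀x(x=x)), for which no quantifier-free formula B(x) of the language of RCF satisfies RCF ⊨_C A↔B. Hence RCF does not admit quantifier elimination over C. -/

import Mathlib

namespace RM

/-- A first-order signature: function symbols with arities and
relation symbols with arities. -/
structure Signature where
  Func : Type
  farity : Func → ℕ
  Rel : Type
  rarity : Rel → ℕ

variable {σ : Signature}

/-- Terms over a signature, with variables indexed by `ℕ`. -/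
inductive Term (σ : Signature) : Type where
  | var : ℕ → Term σ
  | func : (f : σ.Func) → (Fin (σ.farity f) → Term σ) → Term σ

/-- Formulas of the quantificational relevant language:
`⊥`, `⊤`, (logical) equality, atomic relations, `∧`, `∨`, `¬`, `→`, `∀`, `∃`. -/
inductive Formula (σ : Signature) : Type where
  | falsum : Formula σ
  | verum : Formula σ
  | equal : Term σ → Term σ → Formula σ
  | rel : (r : σ.Rel) → (Fin (σ.rarity r) → Term σ) → Formula σ
  | and : Formula σ → Formula σ → Formula σ
  | or : Formula σ → Formula σ → Formula σ
  | neg : Formula σ → Formula σ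
  | imp : Formula σ → Formula σ → Formula σ
  | all : ℕ → Formula σ → Formula σ
  | ex : ℕ → Formula σ → Formula σ

/-- The relevant biconditional `A ↔ B := (A → B) ∧ (B → A)`. -/
def Formula.iff (A B : Formula σ) : Formula σ := .and (.imp A B) (.imp B A)

/-- Free variables of a term. -/
def Term.fv : Term σ → Set ℕ
  | .var n => {n}
  | .func _ ts => ⋃ i, (ts i).fv

/-- Free variables of a formula. -/
def Formula.fv : Formula σ → Set ℕ
  | .falsum => ∅
  | .verum => ∅
  | .equal t u => t.fv ∪ u.fv
  | .rel _ ts => ⋃ i, (ts i).fv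
  | .and A B => A.fv ∪ B.fv
  | .or A B => A.fv ∪ B.fv
  | .imp A B => A.fv ∪ B.fv
  | .neg A => A.fv
  | .all x A => A.fv \ {x}
  | .ex x A => A.fv \ {x}

/-- Quantifier-free formulas. -/
def Formula.QFree : Formula σ → Prop
  | .falsum => True
  | .verum => True
  | .equal _ _ => True
  | .rel _ _ => True
  | .and A B => A.QFree ∧ B.QFree
  | .or A B => A.QFree ∧ B.QFree
  | .imp A B => A.QFree ∧ B.QFree
  | .neg A => A.QFree
  | .all _ _ => False
  | .ex _ _ => False

/-- A sentence is a formula with no free variables. -/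
def Formula.Sentence (A : Formula σ) : Prop := A.fv = ∅

/-- A `B`-model (Routley–Meyer model for the basic relevant logic **B**):
worlds `W`, ternary relation `R`, domain `D`, Routley star `*`,
designated world `s`, world-independent interpretation of function symbols,
world-relative valuation `V` of relation symbols, subject to the usual
conditions; the logical equality symbol is always interpreted as real identity. -/
structure BModel (σ : Signature) where
  W : Type
  R : W → W → W → Prop
  D : Type
  dne : Nonempty D
  star : W → W
  s : W
  interpFunc : (f : σ.Func) → (Fin (σ.farity f) → D) → D
  V : W → (r : σ.Rel) → (Fin (σ.rarity r) → D) → Prop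
  base : ∀ α, R s α α
  btrans : ∀ α β γ δ, R s α β → R β γ δ → R α γ δ
  star_star : ∀ α, star (star α) = α
  star_anti : ∀ α β, R s α β → R s (star β) (star α)
  hered : ∀ α β, R s α β → ∀ r v, V α r v → V β r v

namespace BModel

variable (M : BModel σ)

/-- Evaluation of a term under an assignment. -/
def evalT (a : ℕ → M.D) : Term σ → M.D
  | .var n => a n
  | .func f ts => M.interpFunc f fun i => evalT a (ts i)

/-- Truth of a formula at a world, under an assignment of domain
elements to variables (Routley–Meyer truth conditions). -/
def Truth : M.W → (ℕ → M.D) → Formula σ → Prop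
  | _, _, .falsum => False
  | _, _, .verum => True
  | _, a, .equal t u => M.evalT a t = M.evalT a u
  | w, a, .rel r ts => M.V w r fun i => M.evalT a (ts i)
  | w, a, .and A B => Truth w a A ∧ Truth w a B
  | w, a, .or A B => Truth w a A ∨ Truth w a B
  | w, a, .neg A => ¬ Truth (M.star w) a A
  | w, a, .imp A B => ∀ w₁ w₂, M.R w w₁ w₂ → Truth w₁ a A → Truth w₂ a B
  | w, a, .all x A => ∀ d : M.D, Truth w (Function.update a x d) A
  | w, a, .ex x A => ∃ d : M.D, Truth w (Function.update a x d) A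

/-- `M` satisfies `A` (at the designated world, under every assignment). -/
def SatAx (A : Formula σ) : Prop := ∀ a : ℕ → M.D, M.Truth M.s a A

/-- `M` satisfies the theory `T` at its designated world. -/
def SatTheory (T : Set (Formula σ)) : Prop := ∀ A ∈ T, M.SatAx A

/-- Seriality: every world sees some pair via `R`. -/
def Serial : Prop := ∀ x : M.W, ∃ y z, M.R x y z

/-- The frame condition corresponding to the axiom `K`: `Rαβγ → Rsαγ`. -/
def Kcond : Prop := ∀ α β γ, M.R α β γ → M.R M.s α γ

/-- The additional frame conditions making a `B`-model an `RM`-model. -/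
def IsRM : Prop :=
  (∀ α β γ, M.R α β γ → M.R α (M.star γ) (M.star β)) ∧
  (∀ α β γ, M.R α β γ → M.R α γ β) ∧
  (∀ α, M.R α α α) ∧
  (∀ α β γ δ, (∃ x, M.R α β x ∧ M.R x γ δ) → ∃ y, M.R α y δ ∧ M.R β γ y) ∧
  (∀ α β γ, M.R α β γ → M.R M.s α γ ∨ M.R M.s β γ)

end BModel

/-- Semantic entailment over a class `C` of `B`-models: every model in `C`
whose designated world satisfies all of `T` also satisfies `A` at its
designated world. -/
def Entails (C : BModel σ → Prop) (T : Set (Formula σ)) (A : Formula σ) : Prop :=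
  ∀ M : BModel σ, C M → M.SatTheory T → M.SatAx A

end RM


open RM

/-- Function symbols of the signature of RCF. -/
inductive RCFFunc : Type where
  | plus | times | neg | inv | zero | one

/-- The signature of RCF: function symbols `+ × − ⁻¹ 0 1` and the binary
relation `<`. -/
def rcfSig : Signature :=
  ⟨RCFFunc,
   fun f => match f with
     | .plus => 2 | .times => 2 | .neg => 1 | .inv => 1 | .zero => 0 | .one => 0,
   Unit, fun _ => 2⟩

namespace RCF

def v (n : ℕ) : Term rcfSig := .var n
def lt (t u : Term rcfSig) : Formula rcfSig := .rel () ![t, u]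
def add (t u : Term rcfSig) : Term rcfSig := .func .plus ![t, u]
def mul (t u : Term rcfSig) : Term rcfSig := .func .times ![t, u]
def minus (t : Term rcfSig) : Term rcfSig := .func .neg ![t]
def inv (t : Term rcfSig) : Term rcfSig := .func .inv ![t]
def c0 : Term rcfSig := .func .zero ![]
def c1 : Term rcfSig := .func .one ![]

/-- `t ^ n` as a term (`t ^ 0 = 1`). -/
def pow (t : Term rcfSig) : ℕ → Term rcfSig
  | 0 => c1
  | n + 1 => mul t (pow t n)

/-- The sum of a list of terms. -/
def tsum : List (Term rcfSig) → Term rcfSig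
  | [] => c0
  | [t] => t
  | t :: u :: ts => add t (tsum (u :: ts))

/-- The term `yⁿ + x₁·yⁿ⁻¹ + ⋯ + xₙ`, where `y` is the variable `0` and
`xᵢ` is the variable `i`. -/
def poly (n : ℕ) : Term rcfSig :=
  tsum (pow (v 0) n :: (List.range n).map fun i => mul (v (i + 1)) (pow (v 0) (n - 1 - i)))

/-- Universal closure over a list of variables. -/
def alls (l : List ℕ) (A : Formula rcfSig) : Formula rcfSig := l.foldr Formula.all A

def ax1 : Formula rcfSig := .all 0 (.imp (lt (v 0) (v 0)) .falsum)
def ax2 : Formula rcfSig :=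
  .all 0 (.all 1 (.or (.equal (v 0) (v 1)) (.or (lt (v 0) (v 1)) (lt (v 1) (v 0)))))
def ax3 : Formula rcfSig :=
  .all 0 (.all 1 (.all 2 (.imp (.and (lt (v 0) (v 1)) (lt (v 1) (v 2))) (lt (v 0) (v 2)))))
def ax4 : Formula rcfSig :=
  .all 0 (.all 1 (.imp (.and (lt c0 (v 0)) (lt c0 (v 1))) (lt c0 (mul (v 0) (v 1)))))
def ax5 : Formula rcfSig :=
  .all 0 (.all 1 (.all 2 (.imp (lt (v 0) (v 1)) (lt (add (v 0) (v 2)) (add (v 1) (v 2))))))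
def ax6 : Formula rcfSig := .all 0 (.ex 1 (.imp (lt c0 (v 0)) (.equal (v 0) (mul (v 1) (v 1)))))
/-- A7ₙ: `∀x₁,…,xₙ ∃y (yⁿ + x₁yⁿ⁻¹ + ⋯ + xₙ = 0)` (imposed for odd `n > 0`). -/
def ax7 (n : ℕ) : Formula rcfSig :=
  alls ((List.range n).map (· + 1)) (.ex 0 (.equal (poly n) c0))
def ax8 : Formula rcfSig :=
  .all 0 (.all 1 (.all 2 (.equal (add (add (v 0) (v 1)) (v 2)) (add (v 0) (add (v 1) (v 2))))))
def ax9 : Formula rcfSig := .all 0 (.equal (add (v 0) c0) (v 0))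
def ax10 : Formula rcfSig := .all 0 (.equal (add (v 0) (minus (v 0))) c0)
def ax11 : Formula rcfSig := .all 0 (.all 1 (.equal (add (v 0) (v 1)) (add (v 1) (v 0))))
def ax12 : Formula rcfSig :=
  .all 0 (.all 1 (.all 2 (.equal (mul (mul (v 0) (v 1)) (v 2)) (mul (v 0) (mul (v 1) (v 2))))))
def ax13 : Formula rcfSig := .all 0 (.equal (mul (v 0) c1) (v 0))
def ax14 : Formula rcfSig :=
  .all 0 (.imp (.neg (.equal (v 0) c0)) (.equal (mul (v 0) (inv (v 0))) c1))
def ax15 : Formula rcfSig := .all 0 (.all 1 (.equal (mul (v 0) (v 1)) (mul (v 1) (v 0))))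
def ax16 : Formula rcfSig :=
  .all 0 (.all 1 (.all 2 (.equal (mul (v 0) (add (v 1) (v 2)))
    (add (mul (v 0) (v 1)) (mul (v 0) (v 2))))))
def ax17 : Formula rcfSig := .imp (.equal c0 c1) .falsum

/-- The theory RCF of real closed fields. -/
def theory : Set (Formula rcfSig) :=
  {ax1, ax2, ax3, ax4, ax5, ax6, ax8, ax9, ax10, ax11, ax12, ax13, ax14, ax15, ax16, ax17} ∪
  {A | ∃ n : ℕ, Odd n ∧ 0 < n ∧ A = ax7 n}

end RCF

/-- The formula `∀y,z((x<y ∧ y<z ∧ ¬(y<z)) → ¬∀x(x=x))`, where `x, y, z` are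
the variables `0, 1, 2` (and the inner `∀x` rebinds the variable `0`). -/
def phi : Formula rcfSig :=
  .all 1 (.all 2 (.imp
    (.and (.and (RCF.lt (RCF.v 0) (RCF.v 1)) (RCF.lt (RCF.v 1) (RCF.v 2)))
      (.neg (RCF.lt (RCF.v 1) (RCF.v 2))))
    (.neg (.all 0 (.equal (RCF.v 0) (RCF.v 0))))))


namespace Polynomial

/-- A monic real polynomial of odd degree takes every real value. -/
theorem Monic.eval_surjective_of_odd_natDegree {P : ℝ[X]} (hP : P.Monic) (hodd : Odd P.natDegree) :
    Function.Surjective fun x => P.eval x := by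
  refine P.continuous.surjective ?_ ?_
  · exact P.tendsto_atTop_of_leadingCoeff_nonneg (natDegree_pos_iff_degree_pos.1 hodd.pos)
      (by simp [hP.leadingCoeff])
  · have hdeg : 0 < (P.comp (-X)).degree := by
      rw [← natDegree_pos_iff_degree_pos, natDegree_comp]
      simpa using hodd.pos
    have h := (P.comp (-X)).tendsto_atBot_of_leadingCoeff_nonpos hdeg
      (by simp [comp_neg_X_leadingCoeff_eq, hodd.neg_one_pow, hP.leadingCoeff])
    simpa [Function.comp_def] using h.comp Filter.tendsto_neg_atBot_atTop

end Polynomial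

namespace RCF

open Polynomial in
/-- `yⁿ + b₀ yⁿ⁻¹ + ⋯ + bₙ₋₁` has a real root when `n` is odd. -/
theorem exists_root_of_odd {n : ℕ} (hn : Odd n) (b : ℕ → ℝ) :
    ∃ y : ℝ, y ^ n + ((List.range n).map fun i => b i * y ^ (n - 1 - i)).sum = 0 := by
  set Q : ℝ[X] := ∑ i ∈ Finset.range n, C (b i) * X ^ (n - 1 - i) with hQ
  have hdeg : Q.degree < n := by
    refine (degree_sum_le _ _).trans_lt
      ((Finset.sup_lt_iff (WithBot.bot_lt_coe n)).2 fun i hi => ?_)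
    refine (degree_C_mul_X_pow_le _ _).trans_lt ?_
    have := Finset.mem_range.1 hi
    exact Nat.cast_lt.2 (by omega)
  have hnat : (X ^ n + Q).natDegree = n := by
    refine natDegree_eq_of_degree_eq_some ?_
    rw [degree_add_eq_left_of_degree_lt (by rwa [degree_X_pow]), degree_X_pow]
  obtain ⟨y, hy⟩ := (monic_X_pow_add hdeg).eval_surjective_of_odd_natDegree (hnat.symm ▸ hn) 0
  refine ⟨y, ?_⟩
  have hsum : ((List.range n).map fun i => b i * y ^ (n - 1 - i)).sum =
      ∑ i ∈ Finset.range n, b i * y ^ (n - 1 - i) := rfl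
  simpa [hsum, hQ, eval_finsetSum] using hy

/-- The two-world model on `ℝ` in which the designated world carries the usual order, while the
other world, its star, only keeps the inequalities `x < y` with `y - x ∈ S`. -/
noncomputable def realModel (S : Subring ℝ) : BModel rcfSig where
  W := Bool
  R _ β γ := β = γ
  D := ℝ
  dne := ⟨0⟩
  star := not
  s := true
  interpFunc f := match f with
    | .plus => fun x : Fin 2 → ℝ => x 0 + x 1
    | .times => fun x : Fin 2 → ℝ => x 0 * x 1
    | .neg => fun x : Fin 1 → ℝ => -x 0
    | .inv => fun x : Fin 1 → ℝ => (x 0)⁻¹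
    | .zero => fun _ => 0
    | .one => fun _ => 1
  V w _ := fun x : Fin 2 → ℝ => x 0 < x 1 ∧ (w = true ∨ x 1 - x 0 ∈ S)
  base _ := rfl
  btrans _ _ _ _ _ h := h
  star_star := Bool.not_not
  star_anti _ _ h := by rw [h]
  hered _ _ h _ _ := by rw [h]; exact id

theorem realModel_isRM (S : Subring ℝ) : (realModel S).IsRM := by
  refine ⟨?_, ?_, ?_, ?_, ?_⟩
  · rintro α β _ rfl; rfl
  · rintro α β _ rfl; rfl
  · intro α; rfl
  · rintro α β γ δ ⟨x, rfl, rfl⟩; exact ⟨γ, rfl, rfl⟩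
  · rintro α β _ rfl; exact Or.inr rfl

section Semantics

variable (S : Subring ℝ) (w : Bool) (a : ℕ → ℝ)

/-- Evaluation of terms in `ℝ`. -/
noncomputable def evalReal (t : Term rcfSig) : ℝ := (realModel S).evalT a t

/-- Truth of a formula in `realModel S`. -/
def TruthReal (A : Formula rcfSig) : Prop := (realModel S).Truth w a A

@[simp] theorem evalReal_v (n : ℕ) : evalReal S a (v n) = a n := rfl
@[simp] theorem evalReal_add (t u : Term rcfSig) :
    evalReal S a (add t u) = evalReal S a t + evalReal S a u := rfl
@[simp] theorem evalReal_mul (t u : Term rcfSig) :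
    evalReal S a (mul t u) = evalReal S a t * evalReal S a u := rfl
@[simp] theorem evalReal_minus (t : Term rcfSig) :
    evalReal S a (minus t) = -evalReal S a t := rfl
@[simp] theorem evalReal_inv (t : Term rcfSig) :
    evalReal S a (inv t) = (evalReal S a t)⁻¹ := rfl
@[simp] theorem evalReal_c0 : evalReal S a c0 = 0 := rfl
@[simp] theorem evalReal_c1 : evalReal S a c1 = 1 := rfl

@[simp] theorem evalReal_pow (t : Term rcfSig) (n : ℕ) :
    evalReal S a (pow t n) = evalReal S a t ^ n := by
  induction n with
  | zero => simp [pow]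
  | succ n ih => simp [pow, ih, pow_succ']

@[simp] theorem evalReal_tsum : ∀ l : List (Term rcfSig),
    evalReal S a (tsum l) = (l.map (evalReal S a)).sum
  | [] => rfl
  | [t] => by simp [tsum]
  | t :: u :: ts => by simp [tsum, evalReal_tsum (u :: ts)]

@[simp] theorem truthReal_falsum : TruthReal S w a .falsum ↔ False := Iff.rfl
@[simp] theorem truthReal_equal (t u : Term rcfSig) :
    TruthReal S w a (.equal t u) ↔ evalReal S a t = evalReal S a u := Iff.rfl
@[simp] theorem truthReal_lt (t u : Term rcfSig) :
    TruthReal S w a (lt t u) ↔ evalReal S a t < evalReal S a u ∧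
      (w = true ∨ evalReal S a u - evalReal S a t ∈ S) := Iff.rfl
@[simp] theorem truthReal_and (A B : Formula rcfSig) :
    TruthReal S w a (.and A B) ↔ TruthReal S w a A ∧ TruthReal S w a B := Iff.rfl
@[simp] theorem truthReal_or (A B : Formula rcfSig) :
    TruthReal S w a (.or A B) ↔ TruthReal S w a A ∨ TruthReal S w a B := Iff.rfl
@[simp] theorem truthReal_neg (A : Formula rcfSig) :
    TruthReal S w a (.neg A) ↔ ¬ TruthReal S (!w) a A := Iff.rfl
@[simp] theorem truthReal_all (x : ℕ) (A : Formula rcfSig) :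
    TruthReal S w a (.all x A) ↔ ∀ d : ℝ, TruthReal S w (Function.update a x d) A := Iff.rfl
@[simp] theorem truthReal_ex (x : ℕ) (A : Formula rcfSig) :
    TruthReal S w a (.ex x A) ↔ ∃ d : ℝ, TruthReal S w (Function.update a x d) A := Iff.rfl

@[simp] theorem truthReal_imp (A B : Formula rcfSig) :
    TruthReal S w a (.imp A B) ↔ ∀ w', TruthReal S w' a A → TruthReal S w' a B :=
  ⟨fun h w' => h w' w' rfl, fun h w₁ w₂ (e : w₁ = w₂) => e ▸ h w₁⟩

theorem truthReal_alls (l : List ℕ) {A : Formula rcfSig} (h : ∀ a, TruthReal S w a A) :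
    TruthReal S w a (alls l A) := by
  induction l generalizing a with
  | nil => exact h a
  | cons x l ih => exact fun d => ih (Function.update a x d)

end Semantics

theorem realModel_satTheory (S : Subring ℝ) : (realModel S).SatTheory theory := by
  intro A hA (a : ℕ → ℝ)
  change TruthReal S true a A
  rcases hA with hA | ⟨n, hn, -, rfl⟩
  · simp only [Set.mem_insert_iff, Set.mem_singleton_iff] at hA
    rcases hA with rfl | rfl | rfl | rfl | rfl | rfl | rfl | rfl | rfl | rfl | rfl | rfl | rfl |
      rfl | rfl | rfl
    · simp [ax1]
    · intro (x : ℝ) (y : ℝ)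
      rcases lt_trichotomy x y with h | h | h
      · exact Or.inr (Or.inl ⟨h, Or.inl rfl⟩)
      · exact Or.inl h
      · exact Or.inr (Or.inr ⟨h, Or.inl rfl⟩)
    · simp only [ax3, truthReal_all, truthReal_imp, truthReal_and, truthReal_lt, evalReal_v]
      rintro x y z w ⟨⟨hxy, h₁⟩, hyz, h₂⟩
      refine ⟨hxy.trans hyz, ?_⟩
      rcases h₁ with h₁ | h₁
      · exact Or.inl h₁
      rcases h₂ with h₂ | h₂
      · exact Or.inl h₂
      · exact Or.inr (by simpa using S.add_mem h₂ h₁)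
    · simp only [ax4, truthReal_all, truthReal_imp, truthReal_and, truthReal_lt, evalReal_v,
        evalReal_c0, evalReal_mul, sub_zero]
      rintro x y w ⟨⟨hx, h₁⟩, hy, h₂⟩
      refine ⟨mul_pos hx hy, ?_⟩
      rcases h₁ with h₁ | h₁
      · exact Or.inl h₁
      rcases h₂ with h₂ | h₂
      · exact Or.inl h₂
      · exact Or.inr (S.mul_mem h₁ h₂)
    · simp [ax5]
    · simp only [ax6, truthReal_all, truthReal_ex, truthReal_imp, truthReal_lt, truthReal_equal,
        evalReal_v, evalReal_c0, evalReal_mul]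
      intro x
      refine ⟨√x, ?_⟩
      rintro w ⟨hx, -⟩
      simpa using (Real.mul_self_sqrt (by simpa using hx.le)).symm
    · simp [ax8, add_assoc]
    · simp [ax9]
    · simp [ax10]
    · simp [ax11, add_comm]
    · simp [ax12, mul_assoc]
    · simp [ax13]
    · simp only [ax14, truthReal_all, truthReal_imp, truthReal_neg, truthReal_equal, evalReal_v,
        evalReal_c0, evalReal_c1, evalReal_mul, evalReal_inv]
      exact fun x _ hx => mul_inv_cancel₀ hx
    · simp [ax15, mul_comm]
    · simp [ax16, mul_add]
    · simp [ax17]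
  · refine truthReal_alls S true a _ fun b => ?_
    obtain ⟨y, hy⟩ := exists_root_of_odd hn fun i => b (i + 1)
    rw [truthReal_ex]
    exact ⟨y, by simpa [poly, Function.comp_def] using hy⟩

/-- Closed terms take values in every subfield. -/
theorem evalReal_zero_mem (S : Subring ℝ) (K : Subfield ℝ) (t : Term rcfSig) :
    evalReal S (fun _ => 0) t ∈ K := by
  induction t with
  | var n => exact K.zero_mem
  | func f ts ih =>
    cases f with
    | plus => exact K.add_mem (ih (0 : Fin 2)) (ih (1 : Fin 2))
    | times => exact K.mul_mem (ih (0 : Fin 2)) (ih (1 : Fin 2))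
    | neg => exact K.neg_mem (ih (0 : Fin 1))
    | inv => exact K.inv_mem (ih (0 : Fin 1))
    | zero => exact K.zero_mem
    | one => exact K.one_mem

theorem evalReal_congr (S T : Subring ℝ) (a : ℕ → ℝ) (t : Term rcfSig) :
    evalReal S a t = evalReal T a t := by
  induction t with
  | var n => rfl
  | func f ts ih => exact congrArg ((realModel S).interpFunc f) (funext ih)

/-- Quantifier-free formulas at the zero assignment do not distinguish between subfields. -/
theorem truthReal_zero_congr (K L : Subfield ℝ) {B : Formula rcfSig} (hB : B.QFree) (w : Bool) :
    TruthReal K.toSubring w (fun _ => 0) B ↔ TruthReal L.toSubring w (fun _ => 0) B := by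
  induction B generalizing w with
  | falsum => exact Iff.rfl
  | verum => exact Iff.rfl
  | equal t u =>
    simp only [truthReal_equal, evalReal_congr K.toSubring L.toSubring]
  | rel r ts =>
    have aux (M : Subfield ℝ) : TruthReal M.toSubring w (fun _ => 0) (.rel r ts) ↔
        evalReal ⊤ (fun _ => 0) (ts (0 : Fin 2)) < evalReal ⊤ (fun _ => 0) (ts (1 : Fin 2)) := by
      simp only [evalReal_congr ⊤ M.toSubring]
      exact ⟨fun h => h.1, fun h =>
        ⟨h, Or.inr (M.sub_mem (evalReal_zero_mem _ M _) (evalReal_zero_mem _ M _))⟩⟩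
    rw [aux, aux]
  | and A B ihA ihB => exact and_congr (ihA hB.1 w) (ihB hB.2 w)
  | or A B ihA ihB => exact or_congr (ihA hB.1 w) (ihB hB.2 w)
  | neg A ih => exact not_congr (ih hB _)
  | imp A B ihA ihB =>
    simp only [truthReal_imp]
    exact forall_congr' fun w' => imp_congr (ihA hB.1 w') (ihB hB.2 w')
  | all x A => exact hB.elim
  | ex x A => exact hB.elim

theorem truthReal_phi_top (a : ℕ → ℝ) : TruthReal (⊤ : Subfield ℝ).toSubring true a phi := by
  simp only [phi, truthReal_all, truthReal_imp, truthReal_and, truthReal_neg, truthReal_lt]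
  rintro y z w ⟨⟨-, h, -⟩, hn⟩
  exact absurd ⟨h, Or.inr (Subfield.mem_top _)⟩ hn

theorem not_truthReal_phi_rat :
    ¬ TruthReal (algebraMap ℚ ℝ).fieldRange.toSubring true (fun _ => 0) phi := by
  intro h
  simp only [phi, truthReal_all, truthReal_imp, truthReal_and, truthReal_neg, truthReal_lt] at h
  refine h 1 (1 + √2) true ⟨⟨by simp, by simp⟩, ?_⟩ (by simp)
  simpa [Irrational] using irrational_sqrt_two

end RCF

open RCF in
/-- **Failure of quantifier elimination for RCF** in any relevant logic
between **B** and **RM**: over any class `C` of `B`-models containing all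
`RM`-models, the formula `∀y,z((x<y ∧ y<z ∧ ¬(y<z)) → ¬∀x(x=x))` is not
RCF-equivalent over `C` to any quantifier-free formula in the variable `x`. -/
theorem stmt_8 (C : BModel rcfSig → Prop) (hC : ∀ M : BModel rcfSig, M.IsRM → C M) :
    ¬ ∃ B : Formula rcfSig, B.QFree ∧ B.fv ⊆ {0} ∧ Entails C RCF.theory (phi.iff B) := by
  rintro ⟨B, hB, -, hE⟩
  have key (K : Subfield ℝ) : TruthReal K.toSubring true (fun _ => 0) phi ↔
      TruthReal K.toSubring true (fun _ => 0) B := by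
    have h := hE _ (hC _ (realModel_isRM K.toSubring)) (realModel_satTheory K.toSubring)
      fun _ => (0 : ℝ)
    exact ⟨h.1 true true rfl, h.2 true true rfl⟩
  exact not_truthReal_phi_rat ((key _).2
    ((truthReal_zero_congr ⊤ _ hB true).1 ((key ⊤).1 (truthReal_phi_top _))))
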